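/- arXiv:1404.3677 — 3 statements merged into one kernel-verified Lean document; each statement's English description precedes it below -/
import Mathlib

section
/- Let g, b > 0 and p, q ∈ [0,1] with p·g + q·b > 0, let M = ![![1−b, b], ![g, 1−g]], μ = 1 − g − b, and let k be a natural number. Define the joint probability mass function J on (Bool × Bool) × (Bool × Bool) by J((c₀,x₀),(c,x)) = π(c₀)·em(c₀,x₀)·(M^k)(c₀,c)·em(c,x), where π(G) = g/(g+b), π(B) = b/(g+b), em(G,1) = p, em(G,0) = 1−p, em(B,1) = q, em(B,0) = 1−q. Then the conditional probability, under J, of the event {x = 1} given the event {x₀ = 1} equals (p·g/(p·g + q·b))·(p + (q−p)·b·∑_{i<k} μ^i) + (q·b/(p·g + q·b))·(q + (p−q)·g·∑_{i<k} μ^i). -/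
/-- Index of a channel state: Good (`true`) ↦ 0, Bad (`false`) ↦ 1. -/
def stateIdx : Bool → Fin 2 := fun c => if c then 0 else 1

/-- Stationary distribution of the Gilbert–Elliott channel. -/
noncomputable def statPi (g b : ℝ) : Bool → ℝ :=
  fun c => if c then g / (g + b) else b / (g + b)

/-- Erasure emission probabilities: probability `p` (resp. `q`) of the erasure
indicator `x` being `true` in the Good (resp. Bad) state. -/
noncomputable def emis (p q : ℝ) : Bool → Bool → ℝ :=
  fun c x => if c then (if x then p else 1 - p) else (if x then q else 1 - q)

/-- Joint probability mass function of (state, erasure) at an initial time and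
`k` steps later, erasures conditionally independent given the states. -/
noncomputable def jointJ (g b p q : ℝ) (k : ℕ) :
    (Bool × Bool) × (Bool × Bool) → ℝ :=
  fun s => statPi g b s.1.1 * emis p q s.1.1 s.1.2 *
    ((!![1 - b, b; g, 1 - g] : Matrix (Fin 2) (Fin 2) ℝ) ^ k)
      (stateIdx s.1.1) (stateIdx s.2.1) * emis p q s.2.1 s.2.2

/-- Powers of a two-state transition matrix in terms of a geometric sum of the memory. -/
theorem twoState_pow {R : Type*} [CommRing R] (g b : R) (k : ℕ) :
    (!![1 - b, b; g, 1 - g] : Matrix (Fin 2) (Fin 2) R) ^ k =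
      !![1 - b * ∑ i ∈ Finset.range k, (1 - g - b) ^ i,
          b * ∑ i ∈ Finset.range k, (1 - g - b) ^ i;
        g * ∑ i ∈ Finset.range k, (1 - g - b) ^ i,
          1 - g * ∑ i ∈ Finset.range k, (1 - g - b) ^ i] := by
  induction k with
  | zero => simp [Matrix.one_fin_two]
  | succ n ih =>
    rw [pow_succ, ih, geom_sum_succ, Matrix.mul_fin_two]
    congr! 3 <;> ring_nf

/-- The probability of losing a transmission `k` steps after an erased transmission
(case f_{ij⁰} = 1 of Theorem 4). -/
theorem erasure_prob_given_past_erasure (g b p q : ℝ) (hg : 0 < g) (hb : 0 < b)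
    (hp : p ∈ Set.Icc (0 : ℝ) 1) (hq : q ∈ Set.Icc (0 : ℝ) 1)
    (hpos : 0 < p * g + q * b) (k : ℕ) :
    (∑ s : (Bool × Bool) × (Bool × Bool),
        if s.2.2 = true ∧ s.1.2 = true then jointJ g b p q k s else 0) /
      (∑ s : (Bool × Bool) × (Bool × Bool),
        if s.1.2 = true then jointJ g b p q k s else 0) =
    (p * g / (p * g + q * b)) *
        (p + (q - p) * b * ∑ i ∈ Finset.range k, (1 - g - b) ^ i) +
      (q * b / (p * g + q * b)) *
        (q + (p - q) * g * ∑ i ∈ Finset.range k, (1 - g - b) ^ i) := by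
  have hgb : g + b ≠ 0 := by positivity
  have hne : p * g + q * b ≠ 0 := hpos.ne'
  simp only [Fintype.sum_prod_type, Fintype.sum_bool, jointJ, statPi, emis, stateIdx,
    twoState_pow]
  generalize ∑ i ∈ Finset.range k, (1 - g - b) ^ i = S
  simp only [Matrix.of_apply, Matrix.cons_val', Matrix.cons_val_zero, Matrix.cons_val_one,
    Matrix.cons_val_fin_one, if_true, Bool.false_eq_true, if_false, and_true, and_false,
    add_zero]
  have hden : g / (g + b) * p * (1 - b * S) * p + g / (g + b) * p * (1 - b * S) * (1 - p) +
          (g / (g + b) * p * (b * S) * q + g / (g + b) * p * (b * S) * (1 - q)) +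
        (b / (g + b) * q * (g * S) * p + b / (g + b) * q * (g * S) * (1 - p) +
          (b / (g + b) * q * (1 - g * S) * q + b / (g + b) * q * (1 - g * S) * (1 - q))) =
      (p * g + q * b) / (g + b) := by
    ring
  rw [hden]
  field_simp
  ring
end

section
/- Let g, b > 0 and p, q ∈ [0,1] with (1−p)·g + (1−q)·b > 0, let M = ![![1−b, b], ![g, 1−g]], μ = 1 − g − b, and let k be a natural number. Define the joint probability mass function J on (Bool × Bool) × (Bool × Bool) by J((c₀,x₀),(c,x)) = π(c₀)·em(c₀,x₀)·(M^k)(c₀,c)·em(c,x), where π(G) = g/(g+b), π(B) = b/(g+b), em(G,1) = p, em(G,0) = 1−p, em(B,1) = q, em(B,0) = 1−q. Then the conditional probability, under J, of the event {x = 1} given the event {x₀ = 0} equals ((1−p)·g/((1−p)·g + (1−q)·b))·(p + (q−p)·b·∑_{i<k} μ^i) + ((1−q)·b/((1−p)·g + (1−q)·b))·(q + (p−q)·g·∑_{i<k} μ^i). -/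
/-- Powers of the two-state transition matrix in terms of the geometric sum of its memory
`1 - g - b`. -/
theorem transition_pow (g b : ℝ) (k : ℕ) :
    (!![1 - b, b; g, 1 - g] : Matrix (Fin 2) (Fin 2) ℝ) ^ k =
      !![1 - b * ∑ i ∈ Finset.range k, (1 - g - b) ^ i,
          b * ∑ i ∈ Finset.range k, (1 - g - b) ^ i;
        g * ∑ i ∈ Finset.range k, (1 - g - b) ^ i,
          1 - g * ∑ i ∈ Finset.range k, (1 - g - b) ^ i] := by
  induction k with
  | zero => simp [Matrix.one_fin_two]
  | succ k ih =>
    rw [pow_succ, ih, geom_sum_succ, Matrix.mul_fin_two]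
    ring_nf

/-- The probability of losing a transmission `k` steps after a received transmission
(case f_{ij⁰} = 0 of Theorem 4). -/
theorem erasure_prob_given_past_reception (g b p q : ℝ) (hg : 0 < g) (hb : 0 < b)
    (hp : p ∈ Set.Icc (0 : ℝ) 1) (hq : q ∈ Set.Icc (0 : ℝ) 1)
    (hpos : 0 < (1 - p) * g + (1 - q) * b) (k : ℕ) :
    (∑ s : (Bool × Bool) × (Bool × Bool),
        if s.2.2 = true ∧ s.1.2 = false then jointJ g b p q k s else 0) /
      (∑ s : (Bool × Bool) × (Bool × Bool),
        if s.1.2 = false then jointJ g b p q k s else 0) =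
    ((1 - p) * g / ((1 - p) * g + (1 - q) * b)) *
        (p + (q - p) * b * ∑ i ∈ Finset.range k, (1 - g - b) ^ i) +
      ((1 - q) * b / ((1 - p) * g + (1 - q) * b)) *
        (q + (p - q) * g * ∑ i ∈ Finset.range k, (1 - g - b) ^ i) := by
  have hgb : g + b ≠ 0 := (add_pos hg hb).ne'
  have num : (∑ s : (Bool × Bool) × (Bool × Bool),
      if s.2.2 = true ∧ s.1.2 = false then jointJ g b p q k s else 0) =
      ((1 - p) * g * (p + (q - p) * b * ∑ i ∈ Finset.range k, (1 - g - b) ^ i) +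
        (1 - q) * b * (q + (p - q) * g * ∑ i ∈ Finset.range k, (1 - g - b) ^ i)) / (g + b) := by
    simp [Fintype.sum_prod_type, jointJ, transition_pow, statPi, emis, stateIdx]
    ring
  have den : (∑ s : (Bool × Bool) × (Bool × Bool),
      if s.1.2 = false then jointJ g b p q k s else 0) =
      ((1 - p) * g + (1 - q) * b) / (g + b) := by
    simp [Fintype.sum_prod_type, jointJ, transition_pow, statPi, emis, stateIdx]
    ring
  rw [num, den, div_div_div_cancel_right₀ hgb]
  ring
end

section
/- Let p, q be real numbers, let g, b, μ, M be as in the Gilbert–Elliott channel setup (M = ![![1−b, b], ![g, 1−g]], μ = 1 − g − b), and let k be a natural number. Then p·(M^k)₀₀ + q·(M^k)₀₁ = p + (q−p)·b·∑_{i<k} μ^i and p·(M^k)₁₀ + q·(M^k)₁₁ = q + (p−q)·g·∑_{i<k} μ^i. -/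
/-- Total probability theorem step of Appendix D: the probability that a transmission
`k` steps later is erased, given the current channel state. -/
theorem erasure_prob_total_probability (p q b g : ℝ) (μ : ℝ) (hμ : μ = 1 - g - b)
    (M : Matrix (Fin 2) (Fin 2) ℝ) (hM : M = !![1 - b, b; g, 1 - g]) (k : ℕ) :
    p * (M ^ k) 0 0 + q * (M ^ k) 0 1 =
      p + (q - p) * b * ∑ i ∈ Finset.range k, μ ^ i ∧
    p * (M ^ k) 1 0 + q * (M ^ k) 1 1 =
      q + (p - q) * g * ∑ i ∈ Finset.range k, μ ^ i := by
  induction k with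
  | zero => simp
  | succ k ih =>
    obtain ⟨h₀, h₁⟩ := ih
    have hgeom := geom_sum_mul μ k
    rw [pow_succ', Finset.sum_range_succ]
    generalize M ^ k = N at *
    generalize ∑ i ∈ Finset.range k, μ ^ i = S at *
    subst hM
    simp only [Matrix.mul_apply, Fin.sum_univ_two, Matrix.of_apply, Matrix.cons_val_zero,
      Matrix.cons_val_one]
    have hμS : (1 - g - b - 1) * S = μ ^ k - 1 := by rw [← hgeom, hμ]; ring
    constructor
    · linear_combination (1 - b) * h₀ + b * h₁ + (q - p) * b * hμS
    · linear_combination g * h₀ + (1 - g) * h₁ + (p - q) * g * hμS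
end
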